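/- arXiv:2406.08378 — 8 statements merged into one kernel-verified Lean document; each statement's English description precedes it below -/
import Mathlib

section
/- Let A, B, C be three affinely independent points of the Euclidean plane ℝ², let D lie in the open segment from B to C, let E lie in the open segment from C to A, and let F lie in the open segment from A to B. Then there exists a point P lying simultaneously on the closed segment from A to D, the closed segment from B to E, and the closed segment from C to F if and only if (dist A E / dist E C) · (dist C D / dist D B) · (dist B F / dist F A) = 1. -/
theorem exists_weights_of_mem_openSegment {V : Type*} [NormedAddCommGroup V] [NormedSpace ℝ V]
    {x y z : V} (hz : z ∈ openSegment ℝ x y) :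
    ∃ a b : ℝ, 0 < a ∧ 0 < b ∧ a + b = 1 ∧ z = a • x + b • y ∧
      dist x z = b * dist x y ∧ dist z y = a * dist x y := by
  obtain ⟨a, b, ha, hb, hab, rfl⟩ := hz
  refine ⟨a, b, ha, hb, hab, rfl, ?_, ?_⟩
  · have h : x - (a • x + b • y) = b • (x - y) := by
      rw [← eq_sub_iff_add_eq] at hab
      subst hab
      module
    rw [dist_eq_norm, dist_eq_norm, h, norm_smul, Real.norm_of_nonneg hb.le]
  · have h : a • x + b • y - y = a • (x - y) := by
      rw [← eq_sub_iff_add_eq'] at hab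
      subst hab
      module
    rw [dist_eq_norm, dist_eq_norm, h, norm_smul, Real.norm_of_nonneg ha.le]

/-- Three cevians whose feet have weights satisfying Ceva's relation are concurrent. -/
theorem exists_mem_segment_of_mul_eq_mul {V : Type*} [AddCommGroup V] [Module ℝ V]
    (A B C : V) {b c d e f g : ℝ} (hb : 0 < b) (hc : 0 < c) (hd : 0 < d) (he : 0 < e)
    (hbc : b + c = 1) (hde : d + e = 1) (hfg : f + g = 1) (h : b * d * f = c * e * g) :
    ∃ P : V, P ∈ segment ℝ A (b • B + c • C) ∧ P ∈ segment ℝ B (d • C + e • A) ∧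
      P ∈ segment ℝ C (f • A + g • B) := by
  have hs : 0 < b * d + c * d + c * e := by positivity
  have hx : (c * e + b * d) * f = c * e := by linear_combination h + c * e * hfg
  have hy : (c * e + b * d) * g = b * d := by linear_combination -h + b * d * hfg
  set s := b * d + c * d + c * e with hs_def
  refine ⟨(c * e / s) • A + (b * d / s) • B + (c * d / s) • C,
    ⟨c * e / s, d / s, by positivity, by positivity, ?_, ?_⟩,
    ⟨b * d / s, c / s, by positivity, by positivity, ?_, ?_⟩,
    ⟨c * d / s, (c * e + b * d) / s, by positivity, by positivity, ?_, ?_⟩⟩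
  · field_simp
    linear_combination hs_def - d * hbc
  · module
  · field_simp
    linear_combination hs_def - c * hde
  · module
  · field_simp
    linear_combination hs_def
  · have hA : c * e / s = (c * e + b * d) / s * f := by rw [div_mul_eq_mul_div, hx]
    have hB : b * d / s = (c * e + b * d) / s * g := by rw [div_mul_eq_mul_div, hy]
    rw [hA, hB]
    module

/-- **Ceva's theorem** in the Euclidean plane `ℝ²`: given a triangle with
affinely independent vertices `A`, `B`, `C`, and points `D`, `E`, `F` in the
open segments `BC`, `CA`, `AB` respectively, the cevians `AD`, `BE`, `CF`
have a common point if and only if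
`(AE/EC) · (CD/DB) · (BF/FA) = 1`. -/
theorem ceva_theorem
    (A B C D E F : EuclideanSpace ℝ (Fin 2))
    (hABC : AffineIndependent ℝ ![A, B, C])
    (hD : D ∈ openSegment ℝ B C)
    (hE : E ∈ openSegment ℝ C A)
    (hF : F ∈ openSegment ℝ A B) :
    (∃ P : EuclideanSpace ℝ (Fin 2),
        P ∈ segment ℝ A D ∧ P ∈ segment ℝ B E ∧ P ∈ segment ℝ C F) ↔
      (dist A E / dist E C) * (dist C D / dist D B) * (dist B F / dist F A) = 1 := by
  have hinj := hABC.injective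
  have hBC : 0 < dist B C := dist_pos.2 (hinj.ne (show (1 : Fin 3) ≠ 2 by decide))
  have hCA : 0 < dist C A := dist_pos.2 (hinj.ne (show (2 : Fin 3) ≠ 0 by decide))
  have hAB : 0 < dist A B := dist_pos.2 (hinj.ne (show (0 : Fin 3) ≠ 1 by decide))
  obtain ⟨b, c, hb, hc, hbc, hD', hBD, hDC⟩ := exists_weights_of_mem_openSegment hD
  obtain ⟨d, e, hd, he, hde, hE', hCE, hEA⟩ := exists_weights_of_mem_openSegment hE
  obtain ⟨f, g, hf, hg, hfg, hF', hAF, hFB⟩ := exists_weights_of_mem_openSegment hF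
  have hratio : (dist A E / dist E C) * (dist C D / dist D B) * (dist B F / dist F A) = 1 ↔
      b * d * f = c * e * g := by
    rw [dist_comm A E, dist_comm E C, dist_comm C D, dist_comm D B, dist_comm B F,
      dist_comm F A, hBD, hDC, hCE, hEA, hAF, hFB, mul_div_mul_right _ _ hBC.ne',
      mul_div_mul_right _ _ hCA.ne', mul_div_mul_right _ _ hAB.ne', div_mul_div_comm,
      div_mul_div_comm, div_eq_one_iff_eq (by positivity), mul_comm d b, mul_comm e c]
  rw [hratio]
  constructor
  · rintro ⟨P, hPD, hPE, hPF⟩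
    have key := Affine.Triangle.prod_dist_eq_prod_dist_of_mem_line_of_mem_line
      (t := ⟨![A, B, C], hABC⟩) (p := ![D, E, F]) (p' := P)
      (fun i ↦ by
        fin_cases i
        · exact (mem_segment_iff_wbtw.1 (openSegment_subset_segment ℝ _ _ hD)).mem_affineSpan
        · exact (mem_segment_iff_wbtw.1 (openSegment_subset_segment ℝ _ _ hE)).mem_affineSpan
        · exact (mem_segment_iff_wbtw.1 (openSegment_subset_segment ℝ _ _ hF)).mem_affineSpan)
      (fun i ↦ by
        fin_cases i
        · exact (mem_segment_iff_wbtw.1 hPD).mem_affineSpan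
        · exact (mem_segment_iff_wbtw.1 hPE).mem_affineSpan
        · exact (mem_segment_iff_wbtw.1 hPF).mem_affineSpan)
    rw [Fin.prod_univ_three, Fin.prod_univ_three] at key
    change dist B D * dist C E * dist A F = dist D C * dist E A * dist F B at key
    rw [hBD, hDC, hCE, hEA, hAF, hFB] at key
    have hpos : 0 < dist B C * dist C A * dist A B := by positivity
    refine mul_right_cancel₀ hpos.ne' ?_
    linear_combination -key
  · intro h
    rw [hD', hE', hF']
    exact exists_mem_segment_of_mul_eq_mul A B C hb hc hd he hbc hde hfg h
end

section
/- Let K be a field and let (d₀, d₁), (e₀, e₁), (f₀, f₁) be three nonzero vectors in K². There exists a nonzero vector v ∈ K³ lying simultaneously in the linear span of {(1,0,0), (0,d₀,d₁)}, in the linear span of {(0,1,0), (e₁,0,e₀)}, and in the linear span of {(0,0,1), (f₀,f₁,0)}, if and only if d₀·e₀·f₀ = d₁·e₁·f₁. -/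
/-- A vector of `K²` is a multiple of a nonzero vector iff their determinant vanishes. -/
theorem exists_smul_eq_iff_mul_eq_mul {K : Type*} [Field K] {a b : K}
    (h : (![a, b] : Fin 2 → K) ≠ 0) (x y : K) :
    (∃ c, c * a = x ∧ c * b = y) ↔ x * b = y * a := by
  constructor
  · rintro ⟨c, rfl, rfl⟩
    ring
  · intro hxy
    by_cases ha : a = 0
    · have hb : b ≠ 0 := by
        rintro rfl
        exact h (by simp [ha])
      refine ⟨y / b, ?_, by field_simp⟩
      have hx : x = 0 := by simpa [ha, hb] using hxy
      simp [ha, hx]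
    · refine ⟨x / a, by field_simp, ?_⟩
      field_simp
      linear_combination hxy

theorem mem_span_first_vertex_iff {K : Type*} [Field K] {a b : K}
    (h : (![a, b] : Fin 2 → K) ≠ 0) (v : Fin 3 → K) :
    v ∈ Submodule.span K {![(1 : K), 0, 0], ![0, a, b]} ↔ v 1 * b = v 2 * a := by
  rw [Submodule.mem_span_pair, ← exists_smul_eq_iff_mul_eq_mul h]
  simp [funext_iff, Fin.forall_fin_succ]

theorem mem_span_second_vertex_iff {K : Type*} [Field K] {a b : K}
    (h : (![a, b] : Fin 2 → K) ≠ 0) (v : Fin 3 → K) :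
    v ∈ Submodule.span K {![(0 : K), 1, 0], ![b, 0, a]} ↔ v 2 * b = v 0 * a := by
  rw [Submodule.mem_span_pair, ← exists_smul_eq_iff_mul_eq_mul h]
  simp [funext_iff, Fin.forall_fin_succ, and_comm]

theorem mem_span_third_vertex_iff {K : Type*} [Field K] {a b : K}
    (h : (![a, b] : Fin 2 → K) ≠ 0) (v : Fin 3 → K) :
    v ∈ Submodule.span K {![(0 : K), 0, 1], ![a, b, 0]} ↔ v 0 * b = v 1 * a := by
  rw [Submodule.mem_span_pair, ← exists_smul_eq_iff_mul_eq_mul h]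
  simp [funext_iff, Fin.forall_fin_succ]


/-- Projective-coordinate form of Ceva's theorem: the three planes in `K³`
spanned by `{(1,0,0),(0,d₀,d₁)}`, `{(0,1,0),(e₁,0,e₀)}`, `{(0,0,1),(f₀,f₁,0)}`
share a nonzero vector if and only if `d₀·e₀·f₀ = d₁·e₁·f₁`. -/
theorem ceva_spans
    (K : Type*) [Field K] (d₀ d₁ e₀ e₁ f₀ f₁ : K)
    (hd : (![d₀, d₁] : Fin 2 → K) ≠ 0)
    (he : (![e₀, e₁] : Fin 2 → K) ≠ 0)
    (hf : (![f₀, f₁] : Fin 2 → K) ≠ 0) :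
    (∃ v : Fin 3 → K, v ≠ 0 ∧
        v ∈ Submodule.span K {![(1 : K), 0, 0], ![0, d₀, d₁]} ∧
        v ∈ Submodule.span K {![(0 : K), 1, 0], ![e₁, 0, e₀]} ∧
        v ∈ Submodule.span K {![(0 : K), 0, 1], ![f₀, f₁, 0]}) ↔
      d₀ * e₀ * f₀ = d₁ * e₁ * f₁ := by
  have hdet : (!![0, d₁, -d₀; -e₀, 0, e₁; f₁, -f₀, 0] : Matrix (Fin 3) (Fin 3) K).det =
      d₁ * e₁ * f₁ - d₀ * e₀ * f₀ := by
    simp [Matrix.det_fin_three]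
    ring
  rw [eq_comm (a := d₀ * e₀ * f₀), ← sub_eq_zero, ← hdet, ← Matrix.exists_mulVec_eq_zero_iff]
  refine exists_congr fun v => and_congr_right fun _ => ?_
  rw [mem_span_first_vertex_iff hd, mem_span_second_vertex_iff he, mem_span_third_vertex_iff hf]
  simp only [funext_iff, Fin.forall_fin_succ, Matrix.mulVec, dotProduct, Fin.sum_univ_three]
  simp
  grind
end

section
/- Let K be a field and let (d₀, d₁), (e₀, e₁), (f₀, f₁) be three nonzero vectors in K². There exists a nonzero vector (x₀, x₁, x₂) ∈ K³ satisfying the three equations x₁·d₁ = x₂·d₀, x₂·e₁ = x₀·e₀, and x₀·f₁ = x₁·f₀, if and only if d₀·e₀·f₀ = d₁·e₁·f₁. -/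
/-- The image of the degree-six del Pezzo surface (the blowup of `ℙ²` in the
three coordinate points) under projection to `ℙ¹ × ℙ¹ × ℙ¹`: there is a
nonzero `(x₀, x₁, x₂)` with `x₁d₁ = x₂d₀`, `x₂e₁ = x₀e₀`, `x₀f₁ = x₁f₀` if and
only if `d₀·e₀·f₀ = d₁·e₁·f₁`. -/
theorem ceva_blowup_image
    (K : Type*) [Field K] (d₀ d₁ e₀ e₁ f₀ f₁ : K)
    (hd : (![d₀, d₁] : Fin 2 → K) ≠ 0)
    (he : (![e₀, e₁] : Fin 2 → K) ≠ 0)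
    (hf : (![f₀, f₁] : Fin 2 → K) ≠ 0) :
    (∃ x : Fin 3 → K, x ≠ 0 ∧
        x 1 * d₁ = x 2 * d₀ ∧ x 2 * e₁ = x 0 * e₀ ∧ x 0 * f₁ = x 1 * f₀) ↔
      d₀ * e₀ * f₀ = d₁ * e₁ * f₁ := by
  have key := Matrix.exists_mulVec_eq_zero_iff
    (M := !![0, d₁, -d₀; -e₀, 0, e₁; f₁, -f₀, 0])
  have hdet : (!![0, d₁, -d₀; -e₀, 0, e₁; f₁, -f₀, 0] : Matrix (Fin 3) (Fin 3) K).det =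
      d₁ * e₁ * f₁ - d₀ * e₀ * f₀ := by
    simp [Matrix.det_fin_three]
    ring
  rw [hdet, sub_eq_zero, eq_comm (a := d₁ * e₁ * f₁)] at key
  rw [← key]
  refine exists_congr fun x => and_congr_right fun _ => ?_
  simp only [funext_iff, Fin.forall_fin_succ, Matrix.mulVec, dotProduct, Fin.sum_univ_three]
  simp
  grind
end

section
/- Let K be a field and let (d₀, d₁), (e₀, e₁), (f₀, f₁) be three nonzero vectors in K². If x = (x₀, x₁, x₂) and y = (y₀, y₁, y₂) are two nonzero vectors in K³ that both satisfy the three equations x₁·d₁ = x₂·d₀, x₂·e₁ = x₀·e₀, x₀·f₁ = x₁·f₀ (and correspondingly y₁·d₁ = y₂·d₀, y₂·e₁ = y₀·e₀, y₀·f₁ = y₁·f₀), then there exists a nonzero scalar λ ∈ K with y = λ·x. -/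
/-- Two solutions of a nonzero linear equation in two unknowns have vanishing determinant. -/
theorem mul_eq_mul_of_common_ratio {K : Type*} [Field K] {c₀ c₁ a b a' b' : K}
    (hc : (![c₀, c₁] : Fin 2 → K) ≠ 0) (h : a * c₁ = b * c₀) (h' : a' * c₁ = b' * c₀) :
    a * b' = a' * b := by
  by_contra hne
  have hdet : a * b' - a' * b ≠ 0 := sub_ne_zero.mpr hne
  have h₀ : c₀ = 0 := (mul_eq_zero.mp (show (a * b' - a' * b) * c₀ = 0 by
    linear_combination a' * h - a * h')).resolve_left hdet
  have h₁ : c₁ = 0 := (mul_eq_zero.mp (show (a * b' - a' * b) * c₁ = 0 by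
    linear_combination b' * h - b * h')).resolve_left hdet
  exact hc (by simp [h₀, h₁])

/-- Two nonzero vectors whose `2 × 2` minors all vanish are proportional. -/
theorem exists_ne_zero_eq_smul_of_mul_eq_mul {ι K : Type*} [Field K] {x y : ι → K}
    (hx : x ≠ 0) (hy : y ≠ 0) (h : ∀ i j, x i * y j = y i * x j) :
    ∃ c : K, c ≠ 0 ∧ y = c • x := by
  obtain ⟨i, hi⟩ := Function.ne_iff.mp hx
  have hi : x i ≠ 0 := hi
  have hyx : y = (y i / x i) • x := by
    ext j
    rw [Pi.smul_apply, smul_eq_mul, div_mul_eq_mul_div, eq_div_iff hi, mul_comm, h]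
  refine ⟨y i / x i, fun h₀ => hy ?_, hyx⟩
  rw [hyx, h₀, zero_smul]

/-- Injectivity of the projection from the blowup of `ℙ²` in the three
coordinate points to `ℙ¹ × ℙ¹ × ℙ¹`: two nonzero solutions of the incidence
equations are proportional. -/
theorem ceva_blowup_injective
    (K : Type*) [Field K] (d₀ d₁ e₀ e₁ f₀ f₁ : K)
    (hd : (![d₀, d₁] : Fin 2 → K) ≠ 0)
    (he : (![e₀, e₁] : Fin 2 → K) ≠ 0)
    (hf : (![f₀, f₁] : Fin 2 → K) ≠ 0)
    (x y : Fin 3 → K) (hx : x ≠ 0) (hy : y ≠ 0)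
    (hx1 : x 1 * d₁ = x 2 * d₀) (hx2 : x 2 * e₁ = x 0 * e₀)
    (hx3 : x 0 * f₁ = x 1 * f₀)
    (hy1 : y 1 * d₁ = y 2 * d₀) (hy2 : y 2 * e₁ = y 0 * e₀)
    (hy3 : y 0 * f₁ = y 1 * f₀) :
    ∃ lam : K, lam ≠ 0 ∧ y = lam • x := by
  have h₁₂ := mul_eq_mul_of_common_ratio hd hx1 hy1
  have h₂₀ := mul_eq_mul_of_common_ratio he hx2 hy2
  have h₀₁ := mul_eq_mul_of_common_ratio hf hx3 hy3
  refine exists_ne_zero_eq_smul_of_mul_eq_mul hx hy fun i j => ?_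
  fin_cases i <;> fin_cases j <;> dsimp <;> grind
end

section
/- Let K be a field and let d₀, d₁, e₀, e₁, f₀, f₁ be nonzero elements of K. There exist a, b, c ∈ K such that the 3×3 matrix with rows (a, d₀, d₁), (e₁, b, e₀), (f₀, f₁, c) has rank at most 1, if and only if d₀·e₀·f₀ = d₁·e₁·f₁. -/
namespace Matrix

/-- A matrix of rank at most one over a field is the outer product of two vectors. -/
theorem exists_eq_vecMulVec_of_rank_le_one {m n K : Type*} [Finite m] [Fintype n] [Field K]
    {A : Matrix m n K} (h : A.rank ≤ 1) : ∃ u v, A = vecMulVec u v := by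
  rw [rank_eq_finrank_span_row, Submodule.finrank_le_one_iff_isPrincipal] at h
  obtain ⟨v, hv⟩ := h.principal
  have hrow (i : m) : ∃ c : K, c • v = A.row i :=
    Submodule.mem_span_singleton.1 (hv ▸ Submodule.subset_span ⟨i, rfl⟩)
  choose u hu using hrow
  exact ⟨u, v, ext fun i j ↦ (congrFun (hu i) j).symm⟩

end Matrix

/-- Matrix-completion form of Ceva's theorem: the partial matrix with
specified off-diagonal entries `d₀, d₁, e₁, e₀, f₀, f₁` (all nonzero) can be
completed to a matrix of rank at most one if and only if
`d₀·e₀·f₀ = d₁·e₁·f₁`. -/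
theorem ceva_matrix_completion
    (K : Type*) [Field K] (d₀ d₁ e₀ e₁ f₀ f₁ : K)
    (hd₀ : d₀ ≠ 0) (hd₁ : d₁ ≠ 0) (he₀ : e₀ ≠ 0) (he₁ : e₁ ≠ 0)
    (hf₀ : f₀ ≠ 0) (hf₁ : f₁ ≠ 0) :
    (∃ a b c : K,
        (!![a, d₀, d₁; e₁, b, e₀; f₀, f₁, c] : Matrix (Fin 3) (Fin 3) K).rank ≤ 1) ↔
      d₀ * e₀ * f₀ = d₁ * e₁ * f₁ := by
  constructor
  · rintro ⟨a, b, c, h⟩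
    obtain ⟨u, v, huv⟩ := Matrix.exists_eq_vecMulVec_of_rank_le_one h
    have entry (i j : Fin 3) := congrFun (congrFun huv i) j
    have h01 : d₀ = u 0 * v 1 := entry 0 1
    have h02 : d₁ = u 0 * v 2 := entry 0 2
    have h10 : e₁ = u 1 * v 0 := entry 1 0
    have h12 : e₀ = u 1 * v 2 := entry 1 2
    have h20 : f₀ = u 2 * v 0 := entry 2 0
    have h21 : f₁ = u 2 * v 1 := entry 2 1
    rw [h01, h02, h10, h12, h20, h21]
    ring
  · intro h
    refine ⟨d₁ * e₁ / e₀, d₀ * e₀ / d₁, e₀ * f₀ / e₁, ?_⟩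
    convert Matrix.rank_vecMulVec_le ![d₁ / e₀, 1, f₀ / e₁] ![e₁, d₀ * e₀ / d₁, e₀] using 2
    ext i j
    fin_cases i <;> fin_cases j <;> simp [Matrix.vecMulVec_apply] <;> field_simp
    linear_combination -h
end

section
/- Let K be a field and n ≥ 2 a natural number. For every pair of indices i < j in {0, …, n} let u_{ij} and v_{ij} be nonzero elements of K (the coordinates (u_{ij} : v_{ij}) of a chosen point on the coordinate line ⟨i,j⟩, with both coordinates nonzero). Then there exists a nonzero vector x = (x₀, …, x_n) ∈ K^{n+1} satisfying x_i·v_{ij} = x_j·u_{ij} for all i < j, if and only if for all triples a < b < c in {0, …, n} the relation u_{ab}·u_{bc}·v_{ac} = v_{ab}·v_{bc}·u_{ac} holds. -/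
/-- The `k = 1` higher-dimensional extension of Ceva's theorem
(cf. Theorem 1 of Buba-Brzozowa): given points `(u i j : v i j)` with both
coordinates nonzero on each coordinate line `⟨i,j⟩` of `ℙⁿ`, there is a
nonzero vector `x` projecting to all of them (`x i · v i j = x j · u i j`)
if and only if Ceva's relation
`u a b · u b c · v a c = v a b · v b c · u a c` holds for all `a < b < c`. -/
theorem ceva_higher_k_one
    (K : Type*) [Field K] (n : ℕ) (hn : 2 ≤ n)
    (u v : Fin (n + 1) → Fin (n + 1) → K)
    (hu : ∀ i j : Fin (n + 1), i < j → u i j ≠ 0)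
    (hv : ∀ i j : Fin (n + 1), i < j → v i j ≠ 0) :
    (∃ x : Fin (n + 1) → K, x ≠ 0 ∧
        ∀ i j : Fin (n + 1), i < j → x i * v i j = x j * u i j) ↔
      (∀ a b c : Fin (n + 1), a < b → b < c →
        u a b * u b c * v a c = v a b * v b c * u a c) := by
  constructor
  · rintro ⟨x, hx, h⟩ a b c hab hbc
    obtain ⟨k, hk⟩ := Function.ne_iff.mp hx
    have hne : ∀ i, x i ≠ 0 := by
      intro i hi
      rcases lt_trichotomy i k with hik | rfl | hki
      · have := h i k hik
        rw [hi, zero_mul] at this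
        exact mul_ne_zero hk (hu i k hik) this.symm
      · exact hk hi
      · have := h k i hki
        rw [hi, zero_mul] at this
        exact mul_ne_zero hk (hv k i hki) this
    apply mul_left_cancel₀ (mul_ne_zero (mul_ne_zero (hne a) (hne b)) (hne c))
    calc x a * x b * x c * (u a b * u b c * v a c)
        = (x b * u a b) * (x c * u b c) * (x a * v a c) := by ring
      _ = (x a * v a b) * (x b * v b c) * (x c * u a c) := by
        rw [h a b hab, h b c hbc, h a c (hab.trans hbc)]
      _ = x a * x b * x c * (v a b * v b c * u a c) := by ring
  · intro h
    refine ⟨fun j => if j = 0 then 1 else v 0 j / u 0 j,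
      Function.ne_iff.mpr ⟨0, by simp⟩, fun i j hij => ?_⟩
    have hj : 0 < j := (Fin.zero_le i).trans_lt hij
    have huj := hu 0 j hj
    rcases eq_or_ne i 0 with rfl | hi
    · simp [hj.ne', huj]
    · have hi' : 0 < i := Fin.pos_iff_ne_zero.mpr hi
      have hui := hu 0 i hi'
      simp only [hi, hj.ne', if_false]
      rw [div_mul_eq_mul_div, div_mul_eq_mul_div, div_eq_div_iff hui huj]
      linear_combination -h 0 i j hi' hij
end

section
/- Let K be a field and let n, k be natural numbers with 2 ≤ k ≤ n. For every subset I of {0, …, n} of cardinality k + 1 and every j ∈ I, let x^I_j be a nonzero element of K (the coordinates of a chosen point P_I in the coordinate subspace ⟨I⟩, all nonzero). Then there exists a vector x = (x₀, …, x_n) ∈ K^{n+1} with all coordinates nonzero such that for every subset I of cardinality k + 1 there is a nonzero scalar c_I ∈ K with x^I_j = c_I · x_j for all j ∈ I, if and only if for all subsets I, J of {0, …, n} of cardinality k + 1 and all i, j ∈ I ∩ J the equality x^I_i · x^J_j = x^I_j · x^J_i holds. -/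
/-- The higher-dimensional extension of Ceva's theorem for `2 ≤ k ≤ n`:
given a point `P_I` with all coordinates `X I j` (`j ∈ I`) nonzero in each
coordinate subspace `⟨I⟩` of `ℙⁿ` with `|I| = k + 1`, these points all arise
as projections of a single point with all coordinates nonzero
(`X I j = c_I · x j` for all `j ∈ I`) if and only if all fully specified
`2 × 2` minors of the matrix `M_{n,k}` vanish
(`X I i · X J j = X I j · X J i` for `i, j ∈ I ∩ J`). -/
theorem ceva_higher_minors
    (K : Type*) [Field K] (n k : ℕ) (hk : 2 ≤ k) (hkn : k ≤ n)
    (X : Finset (Fin (n + 1)) → Fin (n + 1) → K)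
    (hX : ∀ I : Finset (Fin (n + 1)), I.card = k + 1 → ∀ j ∈ I, X I j ≠ 0) :
    (∃ x : Fin (n + 1) → K, (∀ i, x i ≠ 0) ∧
        ∀ I : Finset (Fin (n + 1)), I.card = k + 1 →
          ∃ c : K, c ≠ 0 ∧ ∀ j ∈ I, X I j = c * x j) ↔
      (∀ I J : Finset (Fin (n + 1)), I.card = k + 1 → J.card = k + 1 →
        ∀ i ∈ I ∩ J, ∀ j ∈ I ∩ J, X I i * X J j = X I j * X J i) := by
  constructor
  · rintro ⟨x, -, h⟩ I J hI hJ i hi j hj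
    obtain ⟨c, -, hc⟩ := h I hI
    obtain ⟨d, -, hd⟩ := h J hJ
    rw [Finset.mem_inter] at hi hj
    rw [hc i hi.1, hc j hj.1, hd i hi.2, hd j hj.2]
    ring
  · intro h
    have hext (a b c : Fin (n + 1)) :
        ∃ T : Finset (Fin (n + 1)), a ∈ T ∧ b ∈ T ∧ c ∈ T ∧ T.card = k + 1 := by
      obtain ⟨T, hT, hcard⟩ := Finset.exists_superset_card_eq (s := {a, b, c}) (n := k + 1)
        (Finset.card_le_three.trans (by omega)) (by simpa using hkn)
      exact ⟨T, hT (by simp), hT (by simp), hT (by simp), hcard⟩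
    choose S hS₀ hS _ hScard using fun j => hext 0 j j
    set x : Fin (n + 1) → K := fun j => X (S j) j / X (S j) 0 with hx
    have hx₀ (j : Fin (n + 1)) : x j ≠ 0 :=
      div_ne_zero (hX _ (hScard j) j (hS j)) (hX _ (hScard j) 0 (hS₀ j))
    have hproj (T : Finset (Fin (n + 1))) (hT : T.card = k + 1) (h0 : 0 ∈ T)
        (j : Fin (n + 1)) (hj : j ∈ T) : X T j = X T 0 * x j := by
      have hminor := h (S j) T (hScard j) hT 0 (Finset.mem_inter.2 ⟨hS₀ j, h0⟩)
        j (Finset.mem_inter.2 ⟨hS j, hj⟩)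
      have := hX _ (hScard j) 0 (hS₀ j)
      rw [hx]
      field_simp
      linear_combination hminor
    refine ⟨x, hx₀, fun I hI => ?_⟩
    obtain ⟨i, hi⟩ : I.Nonempty := Finset.card_pos.1 (by omega)
    refine ⟨X I i / x i, div_ne_zero (hX I hI i hi) (hx₀ i), fun j hj => ?_⟩
    obtain ⟨T, h0, hiT, hjT, hT⟩ := hext 0 i j
    have hminor := h I T hI hT i (Finset.mem_inter.2 ⟨hi, hiT⟩) j (Finset.mem_inter.2 ⟨hj, hjT⟩)
    rw [hproj T hT h0 i hiT, hproj T hT h0 j hjT] at hminor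
    rw [div_mul_eq_mul_div, eq_div_iff (hx₀ i)]
    apply mul_left_cancel₀ (hX T hT 0 h0)
    linear_combination -hminor
end

section
/- Let K be a field and let n, k be natural numbers with 2 ≤ k ≤ n. For every subset I of {0, …, n} of cardinality k + 1 and every j ∈ I, let x^I_j be a nonzero element of K, and suppose that for all subsets I, J of {0, …, n} of cardinality k + 1 and all pairs i, j ∈ I ∩ J the equality x^I_i · x^J_j = x^I_j · x^J_i holds. Then there exists a vector x = (x₀, …, x_n) ∈ K^{n+1} with all coordinates nonzero such that for every subset I of cardinality k + 1 there is a nonzero scalar c_I ∈ K with x^I_j = c_I · x_j for all j ∈ I. -/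
/-- Sufficiency direction of the higher-dimensional Ceva theorem for
`2 ≤ k ≤ n`: if the chosen points `P_I` (with all coordinates `X I j` nonzero,
`j ∈ I`, `|I| = k + 1`) satisfy the vanishing of all fully specified `2 × 2`
minors `X I i · X J j = X I j · X J i` for `i, j ∈ I ∩ J`, then they are all
projections of a single point with all coordinates nonzero. -/
theorem ceva_higher_sufficiency
    (K : Type*) [Field K] (n k : ℕ) (hk : 2 ≤ k) (hkn : k ≤ n)
    (X : Finset (Fin (n + 1)) → Fin (n + 1) → K)
    (hX : ∀ I : Finset (Fin (n + 1)), I.card = k + 1 → ∀ j ∈ I, X I j ≠ 0)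
    (hminors : ∀ I J : Finset (Fin (n + 1)), I.card = k + 1 → J.card = k + 1 →
      ∀ i ∈ I ∩ J, ∀ j ∈ I ∩ J, X I i * X J j = X I j * X J i) :
    ∃ x : Fin (n + 1) → K, (∀ i, x i ≠ 0) ∧
      ∀ I : Finset (Fin (n + 1)), I.card = k + 1 →
        ∃ c : K, c ≠ 0 ∧ ∀ j ∈ I, X I j = c * x j := by
  have exists_superset (p j : Fin (n + 1)) :
      ∃ T : Finset (Fin (n + 1)), {0, p, j} ⊆ T ∧ T.card = k + 1 :=
    Finset.exists_superset_card_eq (Finset.card_le_three.trans (by omega))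
      (by rw [Fintype.card_fin]; omega)
  choose S hS hScard using fun i => exists_superset i i
  have zero_mem (i : Fin (n + 1)) : (0 : Fin (n + 1)) ∈ S i := hS i (by simp)
  have self_mem (i : Fin (n + 1)) : i ∈ S i := hS i (by simp)
  have hx (i : Fin (n + 1)) : X (S i) i / X (S i) 0 ≠ 0 :=
    div_ne_zero (hX _ (hScard i) _ (self_mem i)) (hX _ (hScard i) _ (zero_mem i))
  -- The ratio `x i` may be read off from any index set containing `0` and `i`.
  have ratio_eq (T : Finset (Fin (n + 1))) (hT : T.card = k + 1) (h0 : 0 ∈ T)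
      (i : Fin (n + 1)) (hi : i ∈ T) : X (S i) i / X (S i) 0 = X T i / X T 0 := by
    rw [div_eq_div_iff (hX _ (hScard i) _ (zero_mem i)) (hX _ hT _ h0),
      hminors _ T (hScard i) hT i (Finset.mem_inter.2 ⟨self_mem i, hi⟩)
        0 (Finset.mem_inter.2 ⟨zero_mem i, h0⟩), mul_comm]
  refine ⟨fun i => X (S i) i / X (S i) 0, hx, fun I hI => ?_⟩
  obtain ⟨p, hp⟩ : I.Nonempty := Finset.card_pos.1 (by omega)
  refine ⟨X I p / (X (S p) p / X (S p) 0), div_ne_zero (hX I hI p hp) (hx p),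
    fun j hj => ?_⟩
  obtain ⟨T, hT, hTcard⟩ := exists_superset p j
  have h0T : 0 ∈ T := hT (by simp)
  have hpT : p ∈ T := hT (by simp)
  have hjT : j ∈ T := hT (by simp)
  have hT0 := hX T hTcard 0 h0T
  have hTp := hX T hTcard p hpT
  have hminor := hminors I T hI hTcard p (Finset.mem_inter.2 ⟨hp, hpT⟩)
    j (Finset.mem_inter.2 ⟨hj, hjT⟩)
  beta_reduce
  rw [ratio_eq T hTcard h0T p hpT, ratio_eq T hTcard h0T j hjT]
  field_simp
  exact hminor.symm
end
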